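/- There exist a finite ordered alphabet D and upper triangular endomorphisms g1, g2 of the free monoid D* such that, writing H for the submonoid of End(D*) generated by g1 and g2, o for the endomorphism of D* mapping every letter to the empty word, and φ for the monoid homomorphism from the free monoid {1,2}* to End(D*) sending 1 to g1 and 2 to g2, the set of pairs of words (u,v) over {1,2} for which there exist h1, h2 ∈ H with φ(u) h1 = φ(v) h2 ≠ o is not a decidable (computable) predicate on pairs of words. -/

import Mathlib

def IsUpperTriangular {α : Type} [LinearOrder α] (g : Monoid.End (FreeMonoid α)) : Prop :=
  ∀ x y : α, y < x → y ∉ FreeMonoid.toList (g (FreeMonoid.of x))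

/-- The endomorphism `o` mapping every letter (hence every word) to the empty word. -/
def oEnd (α : Type) : Monoid.End (FreeMonoid α) :=
  { toFun := fun _ => 1
    map_one' := rfl
    map_mul' := fun _ _ => (one_mul (1 : FreeMonoid α)).symm }


namespace TriEnd

/-- A deterministic multi-queue machine: in state `q` the letter `a` in front of the queue `key q`
is removed, the word `(out q a).2` is appended to that queue, the next state is `(out q a).1`. -/
structure QM (Q K A : Type) where
  key : Q → K
  out : Q → A → Q × List A
  fin : Q

set_option linter.unusedSectionVars false

variable {Q K A : Type} [DecidableEq Q] [DecidableEq K]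

def QM.step (m : QM Q K A) (c : Q × (K → List A)) : Option (Q × (K → List A)) :=
  if c.1 = m.fin then none else
    match c.2 (m.key c.1) with
    | [] => none
    | a :: r => some ((m.out c.1 a).1, Function.update c.2 (m.key c.1) (r ++ (m.out c.1 a).2))

/-- Letters of the output words. -/
inductive Let (Q A : Type) where
  | bot : Let Q A
  | sep (q : Q) : Let Q A
  | idx (q : Q) (a : A) : Let Q A
  | ltr (a : A) : Let Q A
deriving Fintype

/-- Symbols. -/
inductive Sym (Q K A : Type) where
  | Z : Sym Q K A
  | start : Sym Q K A
  | stp : Sym Q K A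
  | P (k : K) (a : A) : Sym Q K A
  | h (q : Q) (a : A) : Sym Q K A
  | g (q : Q) (a : A) : Sym Q K A
deriving Fintype

/-- Control component. -/
def ctl (m : QM Q K A) (q0 : Q) : Sym Q K A → List (Let Q A)
  | .Z => [.bot]
  | .start => [.bot, .sep q0]
  | .stp => [.sep m.fin]
  | .P _ _ => [.bot]
  | .h q a => [.idx q a, .sep (m.out q a).1]
  | .g q a => [.sep q, .idx q a]

/-- Queue components. -/
def que (m : QM Q K A) (k : K) : Sym Q K A → List A
  | .Z => []
  | .start => []
  | .stp => []
  | .P k' a => if k' = k then [a] else []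
  | .h q a => if m.key q = k then [a] else []
  | .g q a => if m.key q = k then (m.out q a).2 else []

theorem eval_dom_of_none {σ : Type} {f : σ → Option σ} {a : σ} (h : f a = none) :
    (StateTransition.eval f a).Dom :=
  Part.dom_iff_mem.2 ⟨a, StateTransition.mem_eval.2 ⟨Relation.ReflTransGen.refl, h⟩⟩

theorem eval_dom_of_some {σ : Type} {f : σ → Option σ} {a b : σ} (h : f a = some b)
    (hb : (StateTransition.eval f b).Dom) : (StateTransition.eval f a).Dom := by
  obtain ⟨c, hc⟩ := Part.dom_iff_mem.1 hb
  rw [StateTransition.mem_eval] at hc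
  exact Part.dom_iff_mem.2 ⟨c, StateTransition.mem_eval.2 ⟨hc.1.head h, hc.2⟩⟩

theorem tiles_sound (m : QM Q K A) (q0 : Q) (w2 : List (Sym Q K A)) :
    ∀ (w1 : List (Sym Q K A)) (q : Q) (S : K → List A),
      Let.sep q :: w1.flatMap (ctl m q0) = w2.flatMap (ctl m q0) →
      (∀ k, w1.flatMap (que m k) = S k ++ w2.flatMap (que m k)) →
      (StateTransition.eval m.step (q, S)).Dom := by
  induction w2 with
  | nil => intro w1 q S h; simp at h
  | cons x w2 ih =>
    intro w1 q S hc hq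
    by_cases hfin : q = m.fin
    · exact eval_dom_of_none (by simp [QM.step, hfin])
    cases x with
    | Z => simp [ctl] at hc
    | start => simp [ctl] at hc
    | stp => simp [ctl] at hc; exact absurd hc.1 hfin
    | P k a => simp [ctl] at hc
    | h q' a => simp [ctl] at hc
    | g q' a =>
      simp only [List.flatMap_cons, ctl, List.cons_append, List.nil_append, List.cons.injEq,
        Let.sep.injEq] at hc
      obtain ⟨rfl, hc⟩ := hc
      cases w1 with
      | nil => simp at hc
      | cons y w1 =>
        cases y with
        | Z => simp [ctl] at hc
        | start => simp [ctl] at hc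
        | stp => simp [ctl] at hc
        | P k a => simp [ctl] at hc
        | g q' a => simp [ctl] at hc
        | h q' b =>
          simp only [List.flatMap_cons, ctl, List.cons_append, List.nil_append, List.cons.injEq,
            Let.idx.injEq] at hc
          obtain ⟨⟨rfl, rfl⟩, hc⟩ := hc
          cases hS : S (m.key q') with
          | nil => exact eval_dom_of_none (by simp [QM.step, hS])
          | cons a r =>
            have h1 := hq (m.key q')
            simp [que, hS] at h1
            obtain ⟨rfl, h1⟩ := h1
            refine eval_dom_of_some (b := ((m.out q' b).1,
              Function.update S (m.key q') (r ++ (m.out q' b).2))) (by simp [QM.step, hS, hfin])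
              (ih w1 _ _ hc ?_)
            intro k
            by_cases hk : k = m.key q'
            · subst hk; simpa using h1
            · have := hq k
              simp [que, Ne.symm hk] at this
              simpa [hk] using this

theorem exists_drain (m : QM Q K A) (q0 : Q) (l : List K) (hl : l.Nodup) (y : K → List A) :
    ∃ (w1 : List (Sym Q K A)) (n : ℕ),
      w1.flatMap (ctl m q0) = List.replicate n Let.bot ∧
      ∀ k, w1.flatMap (que m k) = if k ∈ l then y k else [] := by
  have aux : ∀ (k : K) (z : List A), ((z.map (Sym.P k)).flatMap (ctl m q0) =
      List.replicate z.length (Let.bot : Let Q A)) ∧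
      ∀ k', (z.map (Sym.P k)).flatMap (que m k') = if k' = k then z else [] := by
    intro k z
    induction z with
    | nil => simp
    | cons a z ih =>
      refine ⟨by simp [ctl, List.replicate_succ, ih.1], fun k' => ?_⟩
      simp only [List.map_cons, List.flatMap_cons, ih.2, que]
      by_cases h : k' = k
      · simp [h]
      · simp [h, Ne.symm h]
  induction l with
  | nil => exact ⟨[], 0, by simp, by simp⟩
  | cons k l ih =>
    obtain ⟨w, n, h1, h2⟩ := ih (List.nodup_cons.1 hl).2
    refine ⟨(y k).map (Sym.P k) ++ w, (y k).length + n, ?_, fun k' => ?_⟩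
    · rw [List.flatMap_append, (aux k (y k)).1, h1, List.replicate_append_replicate]
    · rw [List.flatMap_append, (aux k (y k)).2, h2]
      by_cases h : k' = k
      · subst h; simp [(List.nodup_cons.1 hl).1]
      · simp [h]

theorem tiles_complete [Fintype K] (m : QM Q K A) (q0 : Q) (c d : Q × (K → List A))
    (h : StateTransition.Reaches m.step c d) (hd : d.1 = m.fin) :
    ∃ w1 w2 : List (Sym Q K A),
      Let.sep c.1 :: w1.flatMap (ctl m q0) = w2.flatMap (ctl m q0) ∧
      (∀ k, w1.flatMap (que m k) = c.2 k ++ w2.flatMap (que m k)) := by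
  induction h using Relation.ReflTransGen.head_induction_on with
  | refl =>
    obtain ⟨w, n, h1, h2⟩ := exists_drain m q0 (Finset.univ : Finset K).toList
      (Finset.nodup_toList _) d.2
    have hz : ∀ (n : ℕ), ((List.replicate n (Sym.Z : Sym Q K A)).flatMap (ctl m q0) =
      List.replicate n Let.bot) ∧ ∀ k, (List.replicate n (Sym.Z : Sym Q K A)).flatMap (que m k) = []
        := by
      intro n
      induction n with
      | zero => simp
      | succ n ih => simp [List.replicate_succ, ih.1, ctl, que]
    refine ⟨w, Sym.stp :: List.replicate n Sym.Z, ?_, fun k => ?_⟩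
    · rw [List.flatMap_cons, (hz n).1, h1, hd]; simp [ctl]
    · rw [List.flatMap_cons, (hz n).2, h2]; simp [que]
  | head hab hbd ih =>
    rename_i a b
    obtain ⟨w1, w2, h1, h2⟩ := ih
    obtain ⟨q, S⟩ := a
    simp only [QM.step, Option.mem_def] at hab
    split_ifs at hab with hf
    split at hab
    · simp at hab
    · rename_i x r hS
      obtain rfl := Option.some.inj hab
      refine ⟨Sym.h q x :: w1, Sym.g q x :: w2, by simp [ctl, ← h1], fun k => ?_⟩
      by_cases hk : k = m.key q
      · subst hk
        have := h2 (m.key q)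
        simp at this
        simp [que, this, hS]
      · have := h2 k
        simp [hk] at this
        simp [que, Ne.symm hk, this]

end TriEnd

namespace TriEnd

/-- The letters of the alphabet `D`. -/
inductive Dl (J B : Type) (n : ℕ) where
  | s (j : J) : Dl J B n
  | p (j : J) (i : Fin (n + 1)) : Dl J B n
  | b (x : B) : Dl J B n
deriving Fintype

def Dl.rank {J B : Type} {n : ℕ} : Dl J B n → ℕ
  | .s _ => 0
  | .p _ i => i + 1
  | .b _ => n + 2

theorem exists_rank_equiv {D : Type} [Fintype D] (r : D → ℕ) :
    ∃ (k : ℕ) (e : D ≃ Fin k), ∀ x y, r x < r y → e x < e y := by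
  classical
  let f : D → ℕ ×ₗ Fin (Fintype.card D) := fun x => toLex (r x, Fintype.equivFin D x)
  have hf : Function.Injective f := by
    intro x y h
    have h' : (r x, Fintype.equivFin D x) = (r y, Fintype.equivFin D y) := h
    exact (Fintype.equivFin D).injective (Prod.mk.inj h').2
  let _ : LinearOrder D := LinearOrder.lift' f hf
  let e := (Fintype.orderIsoFinOfCardEq D rfl).symm
  refine ⟨Fintype.card D, e.toEquiv, fun x y h => ?_⟩
  have h1 : f x < f y := Prod.Lex.toLex_lt_toLex.2 (Or.inl h)
  have h2 : x < y := h1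
  exact e.strictMono h2

section
variable {J B : Type} {n : ℕ} (E : J → Fin (n + 1) → List B)

def nx (i : Fin (n + 1)) : Fin (n + 1) := ⟨min (i + 1) n, by omega⟩

def sub : Bool → Dl J B n → List (Dl J B n)
  | false, .s j => [.s j]
  | false, .p j i => [.p j (nx i)]
  | false, .b x => [.b x]
  | true, .s j => [.p j 0, .s j]
  | true, .p j i => (E j i).map .b
  | true, .b x => [.b x]

def run : List Bool → List (Dl J B n) → List (Dl J B n)
  | [], L => L
  | x :: w, L => run w (L.flatMap (sub E x))

theorem run_append (w : List Bool) (L M : List (Dl J B n)) :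
    run E w (L ++ M) = run E w L ++ run E w M := by
  induction w generalizing L M with
  | nil => rfl
  | cons x w ih => simp [run, ih]

theorem run_b (w : List Bool) (L : List B) : run E w (L.map .b) = L.map .b := by
  induction w with
  | nil => rfl
  | cons x w ih =>
    have : (L.map Dl.b).flatMap (sub E x) = L.map (Dl.b (J := J) (n := n)) := by
      clear ih
      induction L with
      | nil => rfl
      | cons a L ih' =>
        rw [List.map_cons, List.flatMap_cons, ih']
        cases x <;> rfl
    rw [run, this, ih]

def dec : Fin (n + 1) → List Bool → List (Fin (n + 1)) × Fin (n + 1)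
  | i, [] => ([], i)
  | i, false :: w => dec (nx i) w
  | i, true :: w => (i :: (dec 0 w).1, (dec 0 w).2)

theorem run_dec (j : J) (w : List Bool) (i : Fin (n + 1)) :
    run E w [.p j i, .s j] =
      ((dec i w).1.flatMap (E j)).map .b ++ [.p j (dec i w).2, .s j] := by
  induction w generalizing i with
  | nil => simp [run, dec]
  | cons x w ih =>
    cases x with
    | false => simpa [run, dec, sub] using ih (nx i)
    | true =>
      have : ([Dl.p j i, .s j].flatMap (sub E true)) = (E j i).map .b ++ [.p j 0, .s j] := by
        simp [sub]
      rw [run, this, run_append, run_b, ih]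
      simp [dec]

def code (U : List (Fin (n + 1))) : List Bool :=
  U.flatMap fun i => List.replicate i false ++ [true]

theorem dec_rep (m : ℕ) (i : Fin (n + 1)) (h : i + m < n + 1) (w : List Bool) :
    dec i (List.replicate m false ++ w) = dec ⟨i + m, h⟩ w := by
  induction m generalizing i with
  | zero => rfl
  | succ m ih =>
    have h1 : (nx i : ℕ) = i + 1 := by simp [nx]; omega
    rw [List.replicate_succ, List.cons_append, dec, ih (nx i) (by omega)]
    congr 1
    ext; simp [h1]; omega

theorem dec_code (U : List (Fin (n + 1))) (w : List Bool) :
    dec 0 (code U ++ w) = (U ++ (dec 0 w).1, (dec 0 w).2) := by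
  induction U with
  | nil => rfl
  | cons i U ih =>
    have : code (i :: U) ++ w = List.replicate i false ++ (true :: (code U ++ w)) := by
      simp [code]
    rw [this, dec_rep _ _ (by simp; omega)]
    simp [dec, ih]

theorem run_eq_iff (U V : List (Fin (n + 1))) :
    (∃ w1 w2 : List Bool, ∀ d : Dl J B n,
      run E (true :: code U ++ w1) [d] = run E (true :: code V ++ w2) [d]) ↔
    ∃ W1 W2 : List (Fin (n + 1)), ∀ j, (U ++ W1).flatMap (E j) = (V ++ W2).flatMap (E j) := by
  have key : ∀ (w : List Bool) (j : J), run E (true :: w) [.s j] =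
      ((dec 0 w).1.flatMap (E j)).map .b ++ [.p j (dec 0 w).2, .s j] := by
    intro w j
    rw [← run_dec]; simp [run, sub]
  constructor
  · rintro ⟨w1, w2, h⟩
    refine ⟨(dec 0 w1).1, (dec 0 w2).1, fun j => ?_⟩
    have := h (.s j)
    rw [List.cons_append, List.cons_append, key, key, dec_code, dec_code] at this
    have := List.append_inj_left' this rfl
    exact List.map_injective_iff.2 (fun x y h => by simpa using h) this
  · rintro ⟨W1, W2, h⟩
    refine ⟨code W1, code W2, fun d => ?_⟩
    cases d with
    | s j =>
      have hd : ∀ U W : List (Fin (n + 1)), dec 0 (code U ++ code W) = (U ++ W, 0) := by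
        intro U W
        rw [dec_code, ← List.append_nil (code W), dec_code]; simp [dec]
      rw [List.cons_append, List.cons_append, key, key, hd, hd]
      simp only [h j]
    | p j i =>
      have : ∀ w, run E (true :: w) [Dl.p j i] = (E j i).map .b := by
        intro w; rw [run]; simpa [sub] using run_b E w (E j i)
      rw [List.cons_append, List.cons_append, this, this]
    | b x =>
      have : ∀ w, run E w [Dl.b x] = [.b x] := fun w => run_b E w [x]
      rw [this, this]

variable {k : ℕ} (e : Dl J B n ≃ Fin k)

def ge (x : Bool) : Monoid.End (FreeMonoid (Fin k)) :=
  FreeMonoid.lift fun a => FreeMonoid.ofList ((sub E x (e.symm a)).map e)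

theorem ge_apply (x : Bool) (L : List (Dl J B n)) :
    ge E e x (FreeMonoid.ofList (L.map e)) = FreeMonoid.ofList ((L.flatMap (sub E x)).map e) := by
  induction L with
  | nil => exact map_one _
  | cons a L ih =>
    rw [List.map_cons, FreeMonoid.ofList_cons, map_mul, ih, List.flatMap_cons, List.map_append,
      FreeMonoid.ofList_append]
    congr 1
    refine (FreeMonoid.lift_eval_of _ _).trans ?_
    rw [Equiv.symm_apply_apply]

variable (φ : FreeMonoid Bool →* (Monoid.End (FreeMonoid (Fin k)))ᵐᵒᵖ)

theorem phi_apply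
    (h1 : φ (FreeMonoid.of false) = MulOpposite.op (ge E e false))
    (h2 : φ (FreeMonoid.of true) = MulOpposite.op (ge E e true))
    (w : List Bool) (L : List (Dl J B n)) :
    (φ (FreeMonoid.ofList w)).unop (FreeMonoid.ofList (L.map e)) =
      FreeMonoid.ofList ((run E w L).map e) := by
  induction w generalizing L with
  | nil => rw [FreeMonoid.ofList_nil, map_one]; rfl
  | cons x w ih =>
    have hx : φ (FreeMonoid.of x) = MulOpposite.op (ge E e x) := by cases x <;> assumption
    rw [FreeMonoid.ofList_cons, map_mul, hx, MulOpposite.unop_mul, MulOpposite.unop_op, run,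
      ← ih, ← ge_apply]
    rfl

theorem phi_eq_iff
    (h1 : φ (FreeMonoid.of false) = MulOpposite.op (ge E e false))
    (h2 : φ (FreeMonoid.of true) = MulOpposite.op (ge E e true))
    (w w' : List Bool) :
    φ (FreeMonoid.ofList w) = φ (FreeMonoid.ofList w') ↔ ∀ d, run E w [d] = run E w' [d] := by
  constructor
  · intro h d
    have := phi_apply E e φ h1 h2 w [d]
    rw [h, phi_apply E e φ h1 h2 w' [d]] at this
    exact (List.map_injective_iff.2 e.injective (FreeMonoid.ofList.injective this)).symm
  · intro h
    apply MulOpposite.unop_injective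
    apply FreeMonoid.hom_eq
    intro a
    have h3 : FreeMonoid.of a = FreeMonoid.ofList ([e.symm a].map e) := by simp
    rw [h3]
    refine (phi_apply E e φ h1 h2 w _).trans (Eq.trans ?_ (phi_apply E e φ h1 h2 w' _).symm)
    rw [h]

theorem mem_closure_iff
    (h1 : φ (FreeMonoid.of false) = MulOpposite.op (ge E e false))
    (h2 : φ (FreeMonoid.of true) = MulOpposite.op (ge E e true))
    (h : Monoid.End (FreeMonoid (Fin k))) :
    h ∈ Submonoid.closure ({ge E e false, ge E e true} : Set (Monoid.End (FreeMonoid (Fin k)))) ↔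
      ∃ w : List Bool, MulOpposite.op h = φ (FreeMonoid.ofList w) := by
  constructor
  · intro hh
    induction hh using Submonoid.closure_induction with
    | mem x hx =>
      rcases hx with rfl | rfl
      · exact ⟨[false], h1.symm⟩
      · exact ⟨[true], h2.symm⟩
    | one => exact ⟨[], by rw [FreeMonoid.ofList_nil, map_one]; rfl⟩
    | mul x y _ _ hx hy =>
      obtain ⟨a, ha⟩ := hx
      obtain ⟨b, hb⟩ := hy
      exact ⟨b ++ a, by rw [MulOpposite.op_mul, ha, hb, FreeMonoid.ofList_append, map_mul]⟩
  · rintro ⟨w, hw⟩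
    obtain rfl : h = (φ (FreeMonoid.ofList w)).unop := by rw [← hw]; rfl
    clear hw
    induction w with
    | nil => rw [FreeMonoid.ofList_nil, map_one]; exact one_mem _
    | cons x w ih =>
      rw [FreeMonoid.ofList_cons, map_mul, MulOpposite.unop_mul]
      refine mul_mem ih (Submonoid.subset_closure ?_)
      cases x
      · rw [h1]; simp
      · rw [h2]; simp

theorem sub_rank (x : Bool) (d y : Dl J B n) (hy : y ∈ sub E x d) : y = d ∨ d.rank < y.rank ∨
    (∃ j, d = .p j (Fin.last n) ∧ y = .p j (Fin.last n)) := by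
  cases x <;> cases d <;> simp only [sub, List.mem_cons, List.not_mem_nil, or_false,
    List.mem_map] at hy
  · exact Or.inl hy
  · rename_i j i
    subst hy
    by_cases h : (i : ℕ) = n
    · refine Or.inr (Or.inr ⟨j, ?_, ?_⟩)
      · congr 1; ext; simpa using h
      · congr 1; ext; simp [nx, h]
    · have := i.2
      refine Or.inr (Or.inl ?_)
      simp [Dl.rank, nx]; omega
  · exact Or.inl hy
  · rcases hy with rfl | rfl
    · exact Or.inr (Or.inl (by simp [Dl.rank]))
    · exact Or.inl rfl
  · rename_i j i
    obtain ⟨a, _, rfl⟩ := hy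
    have := i.2
    exact Or.inr (Or.inl (by simp [Dl.rank]; omega))
  · exact Or.inl hy

theorem ge_triangular (he : ∀ x y : Dl J B n, x.rank < y.rank → e x < e y) (x : Bool) :
    IsUpperTriangular (ge E e x) := by
  intro a c hlt hmem
  have h3 : FreeMonoid.of a = FreeMonoid.ofList ([e.symm a].map e) := by simp
  rw [h3, ge_apply] at hmem
  simp only [List.flatMap_cons, List.flatMap_nil, List.append_nil, FreeMonoid.toList_ofList,
    List.mem_map] at hmem
  obtain ⟨y, hy, rfl⟩ := hmem
  rcases sub_rank E x _ _ hy with rfl | h | ⟨j, hd, rfl⟩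
  · simp at hlt
  · have := he _ _ h
    rw [Equiv.apply_symm_apply] at this
    exact absurd hlt (not_lt.2 this.le)
  · rw [← hd] at hlt; simp at hlt

end

theorem endo_layer {J B : Type} [Fintype J] [Fintype B] [Nonempty B] (n : ℕ)
    (E : J → Fin (n + 1) → List B) :
    ∃ (k : ℕ) (g1 g2 : Monoid.End (FreeMonoid (Fin k))),
      0 < k ∧ IsUpperTriangular g1 ∧ IsUpperTriangular g2 ∧
      ∀ φ : FreeMonoid Bool →* (Monoid.End (FreeMonoid (Fin k)))ᵐᵒᵖ,
        φ (FreeMonoid.of false) = MulOpposite.op g1 →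
        φ (FreeMonoid.of true) = MulOpposite.op g2 →
        ∀ U V : List (Fin (n + 1)),
        ((∃ h1 ∈ Submonoid.closure ({g1, g2} : Set (Monoid.End (FreeMonoid (Fin k)))),
            ∃ h2 ∈ Submonoid.closure ({g1, g2} : Set (Monoid.End (FreeMonoid (Fin k)))),
            φ (FreeMonoid.ofList (true :: code U)) * MulOpposite.op h1 =
              φ (FreeMonoid.ofList (true :: code V)) * MulOpposite.op h2 ∧
            φ (FreeMonoid.ofList (true :: code U)) * MulOpposite.op h1 ≠
              MulOpposite.op (oEnd (Fin k))) ↔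
          ∃ W1 W2 : List (Fin (n + 1)), ∀ j,
            (U ++ W1).flatMap (E j) = (V ++ W2).flatMap (E j)) := by
  obtain ⟨k, e, he⟩ := exists_rank_equiv (Dl.rank (J := J) (B := B) (n := n))
  obtain ⟨x⟩ := (inferInstance : Nonempty B)
  refine ⟨k, ge E e false, ge E e true, Fin.pos (e (.b x)), ge_triangular E e he _,
    ge_triangular E e he _, ?_⟩
  intro φ h1 h2 U V
  rw [← run_eq_iff]
  constructor
  · rintro ⟨a, ha, b, hb, hab, -⟩
    obtain ⟨w1, hw1⟩ := (mem_closure_iff E e φ h1 h2 a).1 ha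
    obtain ⟨w2, hw2⟩ := (mem_closure_iff E e φ h1 h2 b).1 hb
    refine ⟨w1, w2, (phi_eq_iff E e φ h1 h2 _ _).1 ?_⟩
    rw [FreeMonoid.ofList_append, FreeMonoid.ofList_append, map_mul, map_mul, ← hw1, ← hw2, hab]
  · rintro ⟨w1, w2, h⟩
    have h' := (phi_eq_iff E e φ h1 h2 _ _).2 h
    rw [FreeMonoid.ofList_append, FreeMonoid.ofList_append, map_mul, map_mul] at h'
    refine ⟨(φ (FreeMonoid.ofList w1)).unop, (mem_closure_iff E e φ h1 h2 _).2 ⟨w1, rfl⟩,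
      (φ (FreeMonoid.ofList w2)).unop, (mem_closure_iff E e φ h1 h2 _).2 ⟨w2, rfl⟩, h', ?_⟩
    intro ho
    have h3 := phi_apply E e φ h1 h2 (true :: code U ++ w1) ([x].map .b)
    rw [run_b, FreeMonoid.ofList_append, map_mul] at h3
    rw [MulOpposite.op_unop] at ho
    rw [ho] at h3
    have h4 : FreeMonoid.ofList ([] : List (Fin k)) = FreeMonoid.ofList (([x].map Dl.b).map e) := h3
    have := FreeMonoid.ofList.injective h4
    simp at this

end TriEnd

namespace TriEnd

section
open Turing

set_option linter.unusedSectionVars false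

theorem QM.step_fin {Q K A : Type} [DecidableEq Q] [DecidableEq K] (m : QM Q K A) (q : Q)
    (S : K → List A) (hq : q = m.fin) : m.step (q, S) = none := by
  simp [QM.step, hq]

theorem QM.step_nil {Q K A : Type} [DecidableEq Q] [DecidableEq K] (m : QM Q K A) (q : Q)
    (S : K → List A) (hS : S (m.key q) = []) : m.step (q, S) = none := by
  simp [QM.step, hS]

theorem QM.step_cons {Q K A : Type} [DecidableEq Q] [DecidableEq K] (m : QM Q K A) (q : Q)
    (S : K → List A) (hq : q ≠ m.fin) (a : A) (r : List A) (hS : S (m.key q) = a :: r) :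
    m.step (q, S) =
      some ((m.out q a).1, Function.update S (m.key q) (r ++ (m.out q a).2)) := by
  simp [QM.step, hS, hq]

/-- States of the queue machine simulating a stack machine. -/
inductive QSt (K G Λ σ : Type) where
  | run (q : TM2.Stmt (fun _ : K => G) Λ σ) (v : σ) : QSt K G Λ σ
  | rot (k : K) (q : TM2.Stmt (fun _ : K => G) Λ σ) (v : σ) : QSt K G Λ σ
  | fin : QSt K G Λ σ

noncomputable instance {K G Λ σ : Type} : DecidableEq (QSt K G Λ σ) := Classical.decEq _

variable {K G Λ σ : Type} [DecidableEq K]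

/-- The state after a letter has been moved from the front to the back of queue `k`. -/
def after (k : K) (q : TM2.Stmt (fun _ : K => G) Λ σ) (v : σ) : Option G → QSt K G Λ σ
  | none => .run q v
  | some _ => .rot k q v

def keyF (k0 : K) : QSt K G Λ σ → K
  | .run (.push k _ _) _ => k
  | .run (.peek k _ _) _ => k
  | .run (.pop k _ _) _ => k
  | .run _ _ => k0
  | .rot k _ _ => k
  | .fin => k0

def outF (M : Λ → TM2.Stmt (fun _ : K => G) Λ σ) (k0 : K) :
    QSt K G Λ σ → Option G → QSt K G Λ σ × List (Option G)
  | .run (.push k f q) v, y => (after k q v y, [some (f v), y])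
  | .run (.peek k f q) v, y => (after k q (f v y) y, [y])
  | .run (.pop _ f q) v, none => (.run q (f v none), [none])
  | .run (.pop _ f q) v, some g => (.run q (f v (some g)), [])
  | .run (.load a q) v, y => (after k0 q (a v) y, [y])
  | .run (.branch f q₁ q₂) v, y => (after k0 (cond (f v) q₁ q₂) v y, [y])
  | .run (.goto l) v, y => (after k0 (M (l v)) v y, [y])
  | .run .halt _, _ => (.fin, [])
  | .rot k q v, y => (after k q v y, [y])
  | .fin, _ => (.fin, [])

def qm (M : Λ → TM2.Stmt (fun _ : K => G) Λ σ) (k0 : K) : QM (QSt K G Λ σ) K (Option G) where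
  key := keyF k0
  out := outF M k0
  fin := .fin

/-- The queues representing a tuple of stacks. -/
def enc (S : K → List G) : K → List (Option G) := fun k => (S k).map some ++ [none]

variable (M : Λ → TM2.Stmt (fun _ : K => G) Λ σ) (k0 : K)

theorem rot_reaches (k : K) (q : TM2.Stmt (fun _ : K => G) Λ σ) (v : σ) (l : List G) :
    ∀ (T : K → List (Option G)) (z : List (Option G)), T k = l.map some ++ none :: z →
    StateTransition.Reaches (qm M k0).step (.rot k q v, T)
      (.run q v, Function.update T k (z ++ l.map some ++ [none])) := by
  induction l with
  | nil =>
    intro T z h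
    refine Relation.ReflTransGen.single ?_
    simp at h
    simp [QM.step, qm, keyF, outF, after, h]
  | cons a l ih =>
    intro T z h
    have h1 := ih (Function.update T k (l.map some ++ none :: z ++ [some a])) (z ++ [some a])
      (by simp)
    refine Relation.ReflTransGen.head (b := (.rot k q v,
      Function.update T k (l.map some ++ none :: z ++ [some a]))) ?_ ?_
    · simp at h
      simp [QM.step, qm, keyF, outF, after, h]
    · have h2 : StateTransition.Reaches (qm M k0).step (.rot k q v,
          Function.update T k (l.map some ++ none :: z ++ [some a]))
          (.run q v, Function.update T k (z ++ (a :: l).map some ++ [none])) := by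
        simpa using h1
      exact h2

/-- After moving (possibly) one letter, the machine arrives at `run q v`. -/
theorem after_reaches (k : K) (q : TM2.Stmt (fun _ : K => G) Λ σ) (v : σ) (S : K → List G)
    (x : List G) :
    StateTransition.Reaches (qm M k0).step
      (after k q v ((enc S k).head?.getD none),
        Function.update (enc S) k ((enc S k).tail ++ (x.map some ++ [(enc S k).head?.getD none])))
      (.run q v, enc (Function.update S k (x ++ S k))) := by
  have hu : ∀ L : List G, enc (Function.update S k L) =
      Function.update (enc S) k (L.map some ++ [none]) := by
    intro L
    funext k'
    by_cases h : k' = k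
    · subst h; simp [enc]
    · simp [enc, h]
  cases hS : S k with
  | nil =>
    have : enc S k = [none] := by simp [enc, hS]
    rw [this, hu]
    simp [after]
    exact Relation.ReflTransGen.refl
  | cons a l =>
    have : enc S k = some a :: (l.map some ++ [none]) := by simp [enc, hS]
    rw [this, hu]
    have := rot_reaches M k0 k q v l
      (Function.update (enc S) k (l.map some ++ none :: (x.map some ++ [some a])))
      (x.map some ++ [some a]) (by simp)
    simpa [after] using this

theorem enc_eq_cons (S : K → List G) (k : K) :
    enc S k = (enc S k).head?.getD none :: (enc S k).tail := by
  cases h : S k <;> simp [enc, h]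

theorem enc_head (S : K → List G) (k : K) : (enc S k).head?.getD none = (S k).head? := by
  cases h : S k <;> simp [enc, h]

def trel (c : TM2.Cfg (fun _ : K => G) Λ σ) (b : QSt K G Λ σ × (K → List (Option G))) : Prop :=
  match c.l with
  | none => b.1 = .fin
  | some l => b = (.run (M l) c.var, enc c.stk)

/-- One step of the queue machine. -/
theorem step_run (q : TM2.Stmt (fun _ : K => G) Λ σ) (v : σ) (S : K → List G) (k : K)
    (hk : keyF k0 (.run q v) = k) :
    (qm M k0).step (.run q v, enc S) =
      some ((outF M k0 (.run q v) (S k).head?).1,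
        Function.update (enc S) k ((enc S k).tail ++ (outF M k0 (.run q v) (S k).head?).2)) := by
  subst hk
  have h := enc_eq_cons S (keyF k0 (.run q v))
  rw [enc_head] at h
  exact QM.step_cons (qm M k0) (.run q v) (enc S) (fun h => by cases h) _ _ h

theorem stmt_reaches (q : TM2.Stmt (fun _ : K => G) Λ σ) : ∀ (v : σ) (S : K → List G),
    ∃ b, trel M (TM2.stepAux q v S) b ∧
      StateTransition.Reaches₁ (qm M k0).step (.run q v, enc S) b := by
  have triv : ∀ (S : K → List G) (k : K) (q : TM2.Stmt (fun _ : K => G) Λ σ) (v : σ),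
      StateTransition.Reaches (qm M k0).step
        (after k q v (S k).head?, Function.update (enc S) k ((enc S k).tail ++ [(S k).head?]))
        (.run q v, enc S) := by
    intro S k q v
    have := after_reaches M k0 k q v S []
    simpa [enc_head] using this
  have comb : ∀ {c d : QSt K G Λ σ × (K → List (Option G))} {x},
      (qm M k0).step c = some x → StateTransition.Reaches (qm M k0).step x d →
      StateTransition.Reaches₁ (qm M k0).step c d := by
    intro c d x h1 h2
    exact Relation.TransGen.head' h1 h2
  induction q with
  | push k f q ih =>
    intro v S
    obtain ⟨b, hb, hr⟩ := ih v (Function.update S k (f v :: S k))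
    refine ⟨b, hb, Relation.TransGen.trans (comb (step_run M k0 _ v S k rfl) ?_) hr⟩
    have := after_reaches M k0 k q v S [f v]
    simpa [outF, enc_head] using this
  | peek k f q ih =>
    intro v S
    obtain ⟨b, hb, hr⟩ := ih (f v (S k).head?) S
    exact ⟨b, hb, Relation.TransGen.trans (comb (step_run M k0 _ v S k rfl) (triv _ _ _ _)) hr⟩
  | pop k f q ih =>
    intro v S
    obtain ⟨b, hb, hr⟩ := ih (f v (S k).head?) (Function.update S k (S k).tail)
    refine ⟨b, hb, Relation.TransGen.trans (comb (step_run M k0 _ v S k rfl) ?_) hr⟩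
    have hu : ∀ L : List G, enc (Function.update S k L) =
        Function.update (enc S) k (L.map some ++ [none]) := by
      intro L
      funext k'
      by_cases h : k' = k
      · subst h; simp [enc]
      · simp [enc, h]
    rw [hu]
    cases hS : S k with
    | nil =>
      have : enc S k = [none] := by simp [enc, hS]
      rw [this]; exact Relation.ReflTransGen.refl
    | cons a l =>
      have : enc S k = some a :: (l.map some ++ [none]) := by simp [enc, hS]
      rw [this]
      simp [outF]
      exact Relation.ReflTransGen.refl
  | load a q ih =>
    intro v S
    obtain ⟨b, hb, hr⟩ := ih (a v) S
    exact ⟨b, hb, Relation.TransGen.trans (comb (step_run M k0 _ v S k0 rfl) (triv _ _ _ _)) hr⟩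
  | branch f q₁ q₂ ih₁ ih₂ =>
    intro v S
    cases hf : f v with
    | true =>
      obtain ⟨b, hb, hr⟩ := ih₁ v S
      refine ⟨b, by simpa [hf] using hb, Relation.TransGen.trans
        (comb (step_run M k0 _ v S k0 rfl) ?_) hr⟩
      simpa [outF, hf] using triv S k0 q₁ v
    | false =>
      obtain ⟨b, hb, hr⟩ := ih₂ v S
      refine ⟨b, by simpa [hf] using hb, Relation.TransGen.trans
        (comb (step_run M k0 _ v S k0 rfl) ?_) hr⟩
      simpa [outF, hf] using triv S k0 q₂ v
  | goto l =>
    intro v S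
    exact ⟨_, rfl, comb (step_run M k0 _ v S k0 rfl) (triv _ _ _ _)⟩
  | halt =>
    intro v S
    refine ⟨_, ?_, comb (step_run M k0 _ v S k0 rfl) Relation.ReflTransGen.refl⟩
    show (outF M k0 (.run .halt v) (S k0).head?).1 = _
    rfl

/-- The states over the finite set of relevant statements. -/
def good (S : Finset Λ) : QSt K G Λ σ → Prop
  | .run q _ => some q ∈ TM2.stmts M S
  | .rot _ q _ => some q ∈ TM2.stmts M S
  | .fin => True

theorem good_after (S : Finset Λ) (k : K) (q : TM2.Stmt (fun _ : K => G) Λ σ) (v : σ)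
    (h : some q ∈ TM2.stmts M S) (y : Option G) : good M S (after k q v y) := by
  cases y <;> exact h

theorem good_out (S : Finset Λ) (ss : ∀ l ∈ S, TM2.SupportsStmt S (M l))
    (x : QSt K G Λ σ) (hx : good M S x) (y : Option G) : good M S (outF M k0 x y).1 := by
  cases x with
  | fin => trivial
  | rot k q v => exact good_after M S k q v hx y
  | run q v =>
    have tr : ∀ q', q' ∈ TM2.stmts₁ q → some q' ∈ TM2.stmts M S := fun q' h =>
      TM2.stmts_trans h hx
    cases q with
    | push k f q => exact good_after M S _ _ _ (tr _ (by simp [TM2.stmts₁, TM2.stmts₁_self])) y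
    | peek k f q => exact good_after M S _ _ _ (tr _ (by simp [TM2.stmts₁, TM2.stmts₁_self])) y
    | pop k f q =>
      have := tr q (by simp [TM2.stmts₁, TM2.stmts₁_self])
      cases y <;> exact this
    | load a q => exact good_after M S _ _ _ (tr _ (by simp [TM2.stmts₁, TM2.stmts₁_self])) y
    | branch f q₁ q₂ =>
      refine good_after M S _ _ _ (tr _ ?_) y
      cases f v <;> simp [TM2.stmts₁, TM2.stmts₁_self]
    | goto l =>
      refine good_after M S _ _ _ ?_ y
      simp only [good, TM2.stmts, Finset.mem_insertNone, Finset.mem_biUnion, Option.mem_def,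
        Option.some.injEq, forall_eq'] at hx ⊢
      obtain ⟨a, ha, hq⟩ := hx
      exact ⟨l v, TM2.stmts₁_supportsStmt_mono hq (ss a ha) v, TM2.stmts₁_self⟩
    | halt => trivial

theorem good_finite [Finite K] [Finite σ] (S : Finset Λ) : Finite {x // good M S x} := by
  classical
  let f : Option (Option K × {q // q ∈ TM2.stmts M S} × σ) → QSt K G Λ σ
    | none => .fin
    | some (none, ⟨some q, _⟩, v) => .run q v
    | some (some k, ⟨some q, _⟩, v) => .rot k q v
    | some (_, ⟨none, _⟩, _) => .fin
  refine Set.Finite.subset (Set.finite_range f) ?_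
  intro x hx
  cases x with
  | fin => exact ⟨none, rfl⟩
  | run q v => exact ⟨some (none, ⟨some q, hx⟩, v), rfl⟩
  | rot k q v => exact ⟨some (some k, ⟨some q, hx⟩, v), rfl⟩

theorem tm2_to_qm [Finite K] [Finite σ] (S : Finset Λ) (ss : ∀ l ∈ S, TM2.SupportsStmt S (M l))
    (l0 : Λ) (hl0 : l0 ∈ S) (v0 : σ) (k0 : K) :
    ∃ (Q : Type) (_ : Fintype Q) (_ : DecidableEq Q) (m : QM Q K (Option G)) (q0 : Q),
      ∀ T : K → List G,
        ((StateTransition.eval m.step (q0, enc T)).Dom →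
          (StateTransition.eval (TM2.step M) ⟨some l0, v0, T⟩).Dom) ∧
        ((StateTransition.eval (TM2.step M) ⟨some l0, v0, T⟩).Dom →
          ∃ d, StateTransition.Reaches m.step (q0, enc T) d ∧ d.1 = m.fin) := by
  have := good_finite M S
  let Q := {x // good M S x}
  let m : QM Q K (Option G) :=
    { key := fun x => keyF k0 x.1
      out := fun x y => (⟨(outF M k0 x.1 y).1, good_out M k0 S ss x.1 x.2 y⟩, (outF M k0 x.1 y).2)
      fin := ⟨.fin, trivial⟩ }
  have hinit : good M S (.run (M l0) v0) := by
    simp only [good, TM2.stmts, Finset.mem_insertNone, Finset.mem_biUnion, Option.mem_def,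
      Option.some.injEq, forall_eq']
    exact ⟨l0, hl0, TM2.stmts₁_self⟩
  let vl : Q × (K → List (Option G)) → QSt K G Λ σ × (K → List (Option G)) :=
    fun c => (c.1.1, c.2)
  have hstep : ∀ c, (qm M k0).step (vl c) = (m.step c).map vl := by
    intro c
    by_cases hf : c.1.1 = .fin
    · have : c.1 = m.fin := Subtype.ext hf
      rw [show m.step c = none from QM.step_fin m c.1 c.2 this]
      exact QM.step_fin (qm M k0) c.1.1 c.2 hf
    · have : c.1 ≠ m.fin := fun h => hf (congrArg Subtype.val h)
      cases hc : c.2 (keyF k0 c.1.1) with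
      | nil =>
        rw [show m.step c = none from QM.step_nil m c.1 c.2 hc]
        exact QM.step_nil (qm M k0) c.1.1 c.2 hc
      | cons a r =>
        rw [show m.step c = _ from QM.step_cons m c.1 c.2 this a r hc]
        exact QM.step_cons (qm M k0) c.1.1 c.2 hf a r hc
  have hlift : ∀ c d, StateTransition.Reaches₁ (qm M k0).step (vl c) d →
      ∃ d', vl d' = d ∧ StateTransition.Reaches₁ m.step c d' := by
    intro c d h
    have one : ∀ c y, y ∈ (qm M k0).step (vl c) → ∃ d', vl d' = y ∧ d' ∈ m.step c := by
      intro c y hy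
      rw [hstep] at hy
      obtain ⟨d', h1, h2⟩ := Option.map_eq_some_iff.1 hy
      exact ⟨d', h2, h1⟩
    induction h with
    | single hy =>
      obtain ⟨d', h1, h2⟩ := one _ _ hy
      exact ⟨d', h1, Relation.TransGen.single h2⟩
    | tail _ hy ih =>
      obtain ⟨e, rfl, he⟩ := ih
      obtain ⟨d', h1, h2⟩ := one _ _ hy
      exact ⟨d', h1, he.tail h2⟩
  have hresp : StateTransition.Respects (TM2.step M) m.step (fun c b => trel M c (vl b)) := by
    rintro ⟨l, v, T⟩ b hb
    cases l with
    | none =>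
      have hb' : (vl b).1 = .fin := hb
      have : b.1 = m.fin := Subtype.ext hb'
      simp [QM.step, this]
    | some l =>
      have hb' : vl b = (.run (M l) v, enc T) := hb
      obtain ⟨x, hx, hr⟩ := stmt_reaches M k0 (M l) v T
      rw [← hb'] at hr
      obtain ⟨d', rfl, hd⟩ := hlift _ _ hr
      exact ⟨d', hx, hd⟩
  refine ⟨Q, Fintype.ofFinite Q, inferInstance, m, ⟨_, hinit⟩, fun T => ⟨?_, ?_⟩⟩
  · exact (StateTransition.tr_eval_dom hresp (a₁ := ⟨some l0, v0, T⟩)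
      (a₂ := (⟨_, hinit⟩, enc T)) rfl).1
  · intro h
    obtain ⟨c, hc⟩ := Part.dom_iff_mem.1 h
    obtain ⟨d, hd, hd'⟩ := StateTransition.tr_eval hresp (a₁ := ⟨some l0, v0, T⟩)
      (a₂ := (⟨_, hinit⟩, enc T)) rfl hc
    refine ⟨d, (StateTransition.mem_eval.1 hd').1, ?_⟩
    have hn := (StateTransition.mem_eval.1 hc).2
    obtain ⟨l, v, S⟩ := c
    cases l with
    | none => exact Subtype.ext hd
    | some l => simp at hn

end

end TriEnd

namespace TriEnd

section
open Turing Turing.PartrecToTM2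

/-- Binary increment. -/
def inc : List Bool → List Bool
  | [] => [true]
  | false :: t => true :: t
  | true :: t => false :: inc t

theorem inc_primrec : Primrec inc := by
  have h := Primrec.list_rec (f := fun l : List Bool => l) (g := fun _ => [true])
    (h := fun (_ : List Bool) (p : Bool × List Bool × List Bool) =>
      cond p.1 (false :: p.2.2) (true :: p.2.1))
    Primrec.id (Primrec.const _)
    (Primrec.cond (Primrec.fst.comp Primrec.snd)
      (Primrec.list_cons.comp (Primrec.const false)
        (Primrec.snd.comp (Primrec.snd.comp Primrec.snd)))
      (Primrec.list_cons.comp (Primrec.const true)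
        (Primrec.fst.comp (Primrec.snd.comp Primrec.snd)))).to₂
  refine h.of_eq fun l => ?_
  induction l with
  | nil => rfl
  | cons b t ih => cases b <;> simp [inc, ← ih]

/-- Binary digits. -/
def bits : ℕ → List Bool
  | 0 => []
  | n + 1 => inc (bits n)

theorem bits_primrec : Primrec bits := by
  have h := Primrec.nat_rec₁ ([] : List Bool) (f := fun _ l => inc l)
    (inc_primrec.comp Primrec.snd).to₂
  refine h.of_eq fun n => ?_
  induction n with
  | zero => rfl
  | succ n ih => simp [bits, ← ih]

def bg : Bool → Γ'
  | false => .bit0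
  | true => .bit1

def posBits : PosNum → List Bool
  | .one => [true]
  | .bit0 n => false :: posBits n
  | .bit1 n => true :: posBits n

def numBits : Num → List Bool
  | .zero => []
  | .pos n => posBits n

theorem posBits_succ (p : PosNum) : posBits p.succ = inc (posBits p) := by
  induction p with
  | one => rfl
  | bit0 n ih => rfl
  | bit1 n ih => simp [PosNum.succ, posBits, inc, ih]

theorem numBits_nat (n : ℕ) : numBits (n : Num) = bits n := by
  induction n with
  | zero => rw [Nat.cast_zero]; rfl
  | succ n ih =>
    rw [Nat.cast_succ, Num.add_one, bits, ← ih]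
    rcases (n : Num) with - | a
    · rfl
    · exact posBits_succ a

theorem trPosNum_eq (p : PosNum) : trPosNum p = (posBits p).map bg := by
  induction p with
  | one => rfl
  | bit0 n ih => simp [trPosNum, posBits, bg, ih]
  | bit1 n ih => simp [trPosNum, posBits, bg, ih]

theorem trNat_eq (n : ℕ) : trNat n = (bits n).map bg := by
  rw [← numBits_nat, trNat]
  rcases (n : Num) with - | a
  · rfl
  · exact trPosNum_eq a

theorem exists_code_undec : ∃ c : ToPartrec.Code,
    ¬ ComputablePred fun n : ℕ => (c.eval [n]).Dom := by
  let f : ℕ →. ℕ := fun n => Nat.Partrec.Code.eval (Denumerable.ofNat Nat.Partrec.Code n) 0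
  have hf : Partrec f :=
    Nat.Partrec.Code.eval_part.comp (Computable.ofNat _) (Computable.const 0)
  obtain ⟨c, hc⟩ := ToPartrec.Code.exists_code (Nat.Partrec'.part_iff₁.2 hf)
  refine ⟨c, fun h => ComputablePred.halting_problem 0 ?_⟩
  refine ComputablePred.computable_of_manyOneReducible ?_ h
  refine ⟨Encodable.encode, Computable.encode, fun a => ?_⟩
  have h1 := hc (Encodable.encode a ::ᵥ List.Vector.nil)
  have h2 : c.eval [Encodable.encode a] = pure <$> f (Encodable.encode a) := h1
  show _ ↔ (c.eval [Encodable.encode a]).Dom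
  rw [h2]
  simp [f]

theorem finite_K' : Finite K' :=
  Finite.of_injective (fun k : K' => (K'.rec 0 1 2 3 k : Fin 4)) (by
    intro a b; cases a <;> cases b <;> simp)

/-- The abstract input words. -/
def inU {Q : Type} (l : List Bool) : List (Sym Q K' (Option Γ')) :=
  (l.flatMap fun _ => [.Z]) ++ [.Z, .Z, .Z, .Z, .Z, .start]

def inV {Q : Type} (l : List Bool) : List (Sym Q K' (Option Γ')) :=
  (l.flatMap fun b => [.P .main (some (bg b))]) ++
    [.P .main (some .cons), .P .main none, .P .rev none, .P .aux none, .P .stack none, .Z]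

theorem words_iff {Q : Type} [DecidableEq Q] (m : QM Q K' (Option Γ')) (q0 : Q) (n : ℕ)
    (W1 W2 : List (Sym Q K' (Option Γ'))) :
    (((inU (bits n) ++ W1).flatMap (ctl m q0) = (inV (bits n) ++ W2).flatMap (ctl m q0)) ∧
      ∀ k, (inU (bits n) ++ W1).flatMap (que m k) = (inV (bits n) ++ W2).flatMap (que m k)) ↔
    (Let.sep q0 :: W1.flatMap (ctl m q0) = W2.flatMap (ctl m q0) ∧
      ∀ k, W1.flatMap (que m k) = enc (K'.elim (trList [n]) [] [] []) k ++
        W2.flatMap (que m k)) := by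
  have hc : ∀ l : List Bool, ((inU l ++ W1).flatMap (ctl m q0) =
      (inV l ++ W2).flatMap (ctl m q0)) ↔
      (Let.sep q0 :: W1.flatMap (ctl m q0) = W2.flatMap (ctl m q0)) := by
    intro l
    induction l with
    | nil => simp [inU, inV, ctl]
    | cons b l ih => simpa [inU, inV, ctl] using ih
  have hU : ∀ k, ∀ l : List Bool, (inU (Q := Q) l).flatMap (que m k) = [] := by
    intro k l
    induction l with
    | nil => simp [inU, que]
    | cons b l ih => simpa [inU, que] using ih
  have hV : ∀ k, (inV (Q := Q) (bits n)).flatMap (que m k) =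
      enc (K'.elim (trList [n]) [] [] []) k := by
    intro k
    have : ∀ l : List Bool, (inV (Q := Q) l).flatMap (que m k) =
      enc (K'.elim (l.map bg ++ [Γ'.cons]) [] [] []) k := by
      intro l
      induction l with
      | nil => cases k <;> simp [inV, que, enc, K'.elim]
      | cons b l ih =>
        cases k <;> simp [inV, que, enc, K'.elim] at ih ⊢ <;> exact ih
    rw [this]
    simp [trList, trNat_eq]
  rw [hc]
  refine and_congr_right fun _ => forall_congr' fun k => ?_
  rw [List.flatMap_append, List.flatMap_append, hU, hV, List.nil_append]

theorem main_thm :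
    ∃ (k : ℕ) (g1 g2 : Monoid.End (FreeMonoid (Fin k))),
      0 < k ∧ IsUpperTriangular g1 ∧ IsUpperTriangular g2 ∧
      ∀ φ : FreeMonoid Bool →* (Monoid.End (FreeMonoid (Fin k)))ᵐᵒᵖ,
        φ (FreeMonoid.of false) = MulOpposite.op g1 →
        φ (FreeMonoid.of true) = MulOpposite.op g2 →
        ¬ ComputablePred (fun uv : List Bool × List Bool =>
          ∃ h1 ∈ Submonoid.closure ({g1, g2} : Set (Monoid.End (FreeMonoid (Fin k)))),
            ∃ h2 ∈ Submonoid.closure ({g1, g2} : Set (Monoid.End (FreeMonoid (Fin k)))),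
            φ (FreeMonoid.ofList uv.1) * MulOpposite.op h1 =
              φ (FreeMonoid.ofList uv.2) * MulOpposite.op h2 ∧
            φ (FreeMonoid.ofList uv.1) * MulOpposite.op h1 ≠ MulOpposite.op (oEnd (Fin k))) := by
  obtain ⟨c, hc⟩ := exists_code_undec
  have := finite_K'
  have : Fintype K' := Fintype.ofFinite K'
  have hs := tr_supports c Cont'.halt
  obtain ⟨Q, hQ, hQ', m, q0, hm⟩ := tm2_to_qm tr (codeSupp c Cont'.halt) hs.2
    (trNormal c Cont'.halt) hs.1 (none : Option Γ') K'.main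
  have key : ∀ n, (c.eval [n]).Dom ↔
      (StateTransition.eval (TM2.step tr) ⟨some (trNormal c Cont'.halt), none,
        K'.elim (trList [n]) [] [] []⟩).Dom := by
    intro n
    have h := congrArg Part.Dom (tr_eval c [n])
    exact (iff_of_eq h).symm
  obtain ⟨N, hN⟩ : ∃ N, Fintype.card (Sym Q K' (Option Γ')) = N + 1 :=
    Nat.exists_eq_succ_of_ne_zero (Fintype.card_pos_iff.2 ⟨Sym.Z⟩).ne'
  let e : Sym Q K' (Option Γ') ≃ Fin (N + 1) := Fintype.equivFinOfCardEq hN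
  let E : Option K' → Fin (N + 1) → List (Let Q (Option Γ')) := fun j i =>
    match j with
    | none => ctl m q0 (e.symm i)
    | some k => (que m k (e.symm i)).map Let.ltr
  have : Nonempty (Let Q (Option Γ')) := ⟨.bot⟩
  obtain ⟨k, g1, g2, hk, t1, t2, H⟩ := endo_layer N E
  refine ⟨k, g1, g2, hk, t1, t2, fun φ h1 h2 hcomp => hc ?_⟩
  let u : ℕ → List Bool := fun n => true :: code ((inU (Q := Q) (bits n)).map e)
  let v : ℕ → List Bool := fun n => true :: code ((inV (Q := Q) (bits n)).map e)
  have hcode : ∀ (F : Bool → List (Sym Q K' (Option Γ'))) (C : List (Sym Q K' (Option Γ'))),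
      Primrec fun n => true :: code (((bits n).flatMap F ++ C).map e) := by
    intro F C
    have hp : Primrec fun n => true :: (((bits n).flatMap fun b => code ((F b).map e)) ++
        code (C.map e)) :=
      Primrec.list_cons.comp (Primrec.const true)
        (Primrec.list_append.comp
          (Primrec.list_flatMap bits_primrec
            ((Primrec.dom_bool fun b => code ((F b).map e)).comp Primrec.snd).to₂)
          (Primrec.const _))
    refine hp.of_eq fun n => ?_
    simp [code, List.flatMap_append, List.map_flatMap, List.flatMap_assoc]
  have hu : Computable u := (hcode _ _).to_comp
  have hv : Computable v := (hcode _ _).to_comp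
  refine ComputablePred.computable_of_manyOneReducible ⟨fun n => (u n, v n), hu.pair hv, ?_⟩ hcomp
  intro n
  refine (key n).trans (Iff.trans ?_ (H φ h1 h2 _ _).symm)
  have hE : ∀ w : List (Sym Q K' (Option Γ')),
      (w.map e).flatMap (E none) = w.flatMap (ctl m q0) := by
    intro w
    simp [E, List.flatMap_map]
  have hE' : ∀ k, ∀ w : List (Sym Q K' (Option Γ')),
      (w.map e).flatMap (E (some k)) = (w.flatMap (que m k)).map Let.ltr := by
    intro k w
    simp [E, List.flatMap_map, List.map_flatMap]
  have hinj : Function.Injective (Let.ltr : Option Γ' → Let Q (Option Γ')) := by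
    intro a b h
    injection h
  have hW : ∀ W1 W2 : List (Sym Q K' (Option Γ')),
      (∀ j, ((inU (bits n)).map e ++ W1.map e).flatMap (E j) =
        ((inV (bits n)).map e ++ W2.map e).flatMap (E j)) ↔
      (Let.sep q0 :: W1.flatMap (ctl m q0) = W2.flatMap (ctl m q0) ∧
      ∀ k, W1.flatMap (que m k) = enc (K'.elim (trList [n]) [] [] []) k ++
        W2.flatMap (que m k)) := by
    intro W1 W2
    rw [← words_iff, Option.forall]
    simp only [← List.map_append]
    rw [hE, hE]
    refine and_congr_right fun _ => forall_congr' fun k => ?_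
    rw [hE', hE']
    exact (List.map_injective_iff.2 hinj).eq_iff
  constructor
  · intro h
    obtain ⟨d, hd, hd'⟩ := (hm _).2 h
    obtain ⟨w1, w2, hw⟩ := tiles_complete m q0 _ _ hd hd'
    exact ⟨w1.map e, w2.map e, (hW w1 w2).2 hw⟩
  · rintro ⟨W1, W2, h⟩
    have hm1 : ∀ W : List (Fin (N + 1)), W = (W.map e.symm).map e := by
      intro W; simp
    rw [hm1 W1, hm1 W2] at h
    obtain ⟨a, b⟩ := (hW _ _).1 h
    exact (hm _).1 (tiles_sound m q0 _ _ _ _ a b)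

end

end TriEnd

/-- undecidability of the existence of a nonannihilating solution of
`a x = b y` over the monoid generated by two upper triangular free monoid
endomorphisms.  Since endomorphisms are applied on the right and composed
left-to-right in the paper, the monoid `End(D*)` of the paper is the multiplicative
opposite of Mathlib's `Monoid.End`, and `φ` is a homomorphism into that opposite. -/
theorem statement10 :
    ∃ (k : ℕ) (g1 g2 : Monoid.End (FreeMonoid (Fin k))),
      0 < k ∧ IsUpperTriangular g1 ∧ IsUpperTriangular g2 ∧
      ∀ φ : FreeMonoid Bool →* (Monoid.End (FreeMonoid (Fin k)))ᵐᵒᵖ,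
        φ (FreeMonoid.of false) = MulOpposite.op g1 →
        φ (FreeMonoid.of true) = MulOpposite.op g2 →
        ¬ ComputablePred (fun uv : List Bool × List Bool =>
          ∃ h1 ∈ Submonoid.closure ({g1, g2} : Set (Monoid.End (FreeMonoid (Fin k)))),
            ∃ h2 ∈ Submonoid.closure ({g1, g2} : Set (Monoid.End (FreeMonoid (Fin k)))),
            φ (FreeMonoid.ofList uv.1) * MulOpposite.op h1 =
              φ (FreeMonoid.ofList uv.2) * MulOpposite.op h2 ∧
            φ (FreeMonoid.ofList uv.1) * MulOpposite.op h1 ≠ MulOpposite.op (oEnd (Fin k))) := by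
  exact TriEnd.main_thm
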